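/- Let k be an integer with k ≥ −1 and let ρ be a finite Borel measure on ℝ such that, in case k ≥ 0, the function t ↦ |t|^k is ρ-integrable. Then for every δ ∈ (0, π/2], the quantity sup_{z ∈ Σ(r,δ)} ∫_ℝ |t|^{k+1} / |t − z| ρ(dt) tends to 0 as r → ∞, where Σ(r,δ) := {z ∈ ℂ : |z| ≥ r and δ ≤ arg z ≤ π − δ}. -/

import Mathlib

open MeasureTheory Filter Complex

lemma le_of_sq_le_sq_aux {a b : ℝ} (h : a ^ 2 ≤ b ^ 2) (hb : 0 ≤ b) : a ≤ b :=
  (le_abs_self a).trans (abs_le_of_sq_le_sq h hb)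

lemma sector_lower_aux (δ : ℝ) (hδ1 : 0 < δ) (hδ2 : δ ≤ Real.pi / 2) (r t : ℝ)
    (z : ℂ) (hr : r ≤ ‖z‖) (h1 : δ ≤ z.arg) (h2 : z.arg ≤ Real.pi - δ) :
    Real.sin δ * max |t| r ≤ ‖(t : ℂ) - z‖ := by
  have hs0 : 0 < Real.sin δ := Real.sin_pos_of_pos_of_lt_pi hδ1 (by linarith [Real.pi_pos])
  have hs : Real.sin δ ≤ Real.sin z.arg := by
    rcases le_total z.arg (Real.pi / 2) with h | h
    · exact Real.sin_le_sin_of_le_of_le_pi_div_two (by linarith [Real.pi_pos]) h h1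
    · rw [← Real.sin_pi_sub z.arg]
      exact Real.sin_le_sin_of_le_of_le_pi_div_two (by linarith [Real.pi_pos])
        (by linarith) (by linarith)
  have hre : ‖z‖ * Real.cos z.arg = z.re := Complex.norm_mul_cos_arg z
  have him : ‖z‖ * Real.sin z.arg = z.im := Complex.norm_mul_sin_arg z
  have hsq : ‖(t : ℂ) - z‖ ^ 2 = (t - z.re) ^ 2 + z.im ^ 2 := by
    rw [Complex.sq_norm, Complex.normSq_apply]
    simp
    ring
  have hn := norm_nonneg z
  have hcs := Real.sin_sq_add_cos_sq z.arg
  rw [mul_max_of_nonneg _ _ hs0.le]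
  apply max_le
  · refine le_trans (mul_le_mul_of_nonneg_right hs (abs_nonneg t)) ?_
    refine le_of_sq_le_sq_aux ?_ (norm_nonneg _)
    rw [hsq, mul_pow, sq_abs, ← hre, ← him]
    have hq : Real.sin z.arg ^ 2 = 1 - Real.cos z.arg ^ 2 := by linarith
    rw [mul_pow ‖z‖, hq]
    nlinarith [sq_nonneg (t * Real.cos z.arg - ‖z‖)]
  · refine le_trans (mul_le_mul_of_nonneg_left hr hs0.le) ?_
    refine le_trans (mul_le_mul_of_nonneg_right hs hn) ?_
    refine le_of_sq_le_sq_aux ?_ (norm_nonneg _)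
    rw [hsq, mul_comm, him]
    nlinarith [sq_nonneg (t - z.re)]

/-- the Hamburger–Nevanlinna core estimate.  Let `k ≥ -1` and let `ρ` be a
finite Borel measure on `ℝ` whose `k`-th absolute moment is finite when `k ≥ 0`.  Then
for each `δ ∈ (0, π/2]`, the supremum over `z` in the sector
`Σ(r,δ) = {z : |z| ≥ r, δ ≤ arg z ≤ π - δ}` of `∫ |t|^(k+1)/|t-z| ρ(dt)` tends to `0`
as `r → ∞`. -/
theorem sector_sup_integral_tendsto_zero
    (k : ℤ) (hk : -1 ≤ k)
    (ρ : Measure ℝ) [IsFiniteMeasure ρ]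
    (hint : 0 ≤ k → Integrable (fun t : ℝ => |t| ^ k) ρ)
    (δ : ℝ) (hδ1 : 0 < δ) (hδ2 : δ ≤ Real.pi / 2) :
    Filter.Tendsto
      (fun r : ℝ =>
        ⨆ z ∈ {z : ℂ | r ≤ ‖z‖ ∧ δ ≤ z.arg ∧ z.arg ≤ Real.pi - δ},
          ∫⁻ t : ℝ, ENNReal.ofReal (|t| ^ (k + 1) / ‖(t : ℂ) - z‖) ∂ρ)
      Filter.atTop (nhds 0) := by
  have hs0 : 0 < Real.sin δ := Real.sin_pos_of_pos_of_lt_pi hδ1 (by linarith [Real.pi_pos])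
  obtain ⟨n, hn⟩ : ∃ n : ℕ, k + 1 = (n : ℤ) := ⟨(k + 1).toNat, by omega⟩
  have hB : Integrable (fun t : ℝ => |t| ^ (n - 1) / Real.sin δ) ρ := by
    apply Integrable.div_const
    rcases n with _ | m
    · simp
    · have hkm : k = (m : ℤ) := by push_cast at hn; omega
      subst hkm
      simpa using hint (by positivity)
  have key : Tendsto (fun r : ℝ => ∫⁻ t : ℝ,
      ENNReal.ofReal (|t| ^ n / (Real.sin δ * max |t| r)) ∂ρ) atTop (nhds 0) := by
    have := tendsto_lintegral_filter_of_dominated_convergence (μ := ρ) (l := (atTop : Filter ℝ))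
      (F := fun r t => ENNReal.ofReal (|t| ^ n / (Real.sin δ * max |t| r)))
      (f := fun _ => 0)
      (fun t => ENNReal.ofReal (|t| ^ (n - 1) / Real.sin δ)) ?_ ?_ ?_ ?_
    · simpa using this
    · exact Eventually.of_forall fun r => by fun_prop
    · filter_upwards [eventually_ge_atTop (1 : ℝ)] with r hr
      refine Eventually.of_forall fun t => ENNReal.ofReal_le_ofReal ?_
      have hm : 1 ≤ max |t| r := le_max_of_le_right hr
      have hm2 : |t| ≤ max |t| r := le_max_left _ _
      rw [div_le_div_iff₀ (by positivity) hs0]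
      rcases n with _ | m
      · simp
        nlinarith
      · simp only [Nat.add_sub_cancel, pow_succ]
        have : 0 ≤ |t| ^ m * Real.sin δ := by positivity
        nlinarith [mul_le_mul_of_nonneg_left hm2 this]
    · exact hB.lintegral_lt_top.ne
    · refine Eventually.of_forall fun t => ?_
      rw [← ENNReal.ofReal_zero]
      refine ENNReal.tendsto_ofReal ?_
      apply Tendsto.const_div_atTop
      apply Tendsto.const_mul_atTop hs0
      exact tendsto_atTop_mono (fun r => le_max_right _ _) tendsto_id
  refine tendsto_of_tendsto_of_tendsto_of_le_of_le' tendsto_const_nhds key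
    (Eventually.of_forall fun _ => bot_le) ?_
  filter_upwards [eventually_ge_atTop (1 : ℝ)] with r hr
  refine iSup₂_le fun z hz => lintegral_mono fun t => ENNReal.ofReal_le_ofReal ?_
  have hm : 1 ≤ max |t| r := le_max_of_le_right hr
  rw [hn, zpow_natCast]
  exact div_le_div_of_nonneg_left (by positivity) (by positivity)
    (sector_lower_aux δ hδ1 hδ2 r t z hz.1 hz.2.1 hz.2.2)
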